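/- arXiv:2105.00299 — 2 statements merged into one kernel-verified Lean document; each statement's English description precedes it below -/
import Mathlib

section
/- For every deterministic online algorithm ALG (in the stated online model) that always outputs a dominating set and every integer k ≥ 2, there exist a connected series-parallel finite simple graph G on at most 2 + k + 2k² vertices and a revelation order σ of its vertices in which every prefix induces a connected subgraph, such that ALG(G,σ) ≥ (k/2)·γ(G). -/
open SimpleGraph

attribute [local instance] Classical.propDecidable

/-- `D` is a dominating set of `G`: every vertex is in `D` or adjacent to a member of `D`. -/
def IsDomSet {V : Type*} (G : SimpleGraph V) (D : Set V) : Prop :=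
  ∀ v : V, v ∈ D ∨ ∃ u ∈ D, G.Adj u v

/-- The domination number `γ(G)`: the minimum size of a dominating set. -/
noncomputable def domNum {V : Type*} [Fintype V] (G : SimpleGraph V) : ℕ :=
  sInf {k | ∃ D : Finset V, IsDomSet G ↑D ∧ D.card = k}

/-- Every prefix `{v_0, …, v_i}` of the revelation order induces a connected subgraph.
(The input graph is presented on `Fin n`, vertex `i` being revealed at time `i`.) -/
def PrefixConnected {n : ℕ} (G : SimpleGraph (Fin n)) : Prop :=
  ∀ i : Fin n, (SimpleGraph.induce {v : Fin n | v ≤ i} G).Connected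

/-- The information revealed by time `i`: the list of closed neighborhoods
`N[v_0], …, N[v_i]`, each as a set of natural-number vertex labels. -/
def history {n : ℕ} (G : SimpleGraph (Fin n)) (i : Fin n) : List (Set ℕ) :=
  (List.range ((i : ℕ) + 1)).map fun j =>
    {m : ℕ | ∃ v w : Fin n, (v : ℕ) = j ∧ (w : ℕ) = m ∧ (v = w ∨ G.Adj v w)}

/-- The set of vertices selected by the deterministic online algorithm `A`: the
(irrevocable) decision at time `i` is a function only of the information revealed
by time `i`. -/
noncomputable def algOutput {n : ℕ} (A : List (Set ℕ) → Bool) (G : SimpleGraph (Fin n)) :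
    Finset (Fin n) :=
  Finset.univ.filter fun i => A (history G i) = true

/-- The online algorithm `A` outputs a dominating set on every valid online input. -/
def AlwaysDominating (A : List (Set ℕ) → Bool) : Prop :=
  ∀ (n : ℕ) (G : SimpleGraph (Fin n)), G.Connected → PrefixConnected G →
    IsDomSet G ↑(algOutput A G)

/-- A two-terminal graph: a graph with a distinguished source and sink. -/
structure TwoTerminal : Type 1 where
  V : Type
  G : SimpleGraph V
  s : V
  t : V

/-- `C` is the series composition of `A` and `B`: a disjoint union with the sink of `A`
identified with the source of `B`. -/
def IsSeriesComp (A B C : TwoTerminal) : Prop :=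
  ∃ (f : A.V → C.V) (g : B.V → C.V),
    Function.Injective f ∧ Function.Injective g ∧
    (∀ c : C.V, (∃ a, f a = c) ∨ (∃ b, g b = c)) ∧
    (∀ a b, f a = g b ↔ a = A.t ∧ b = B.s) ∧
    (∀ x y, C.G.Adj x y ↔
      ((∃ a a', f a = x ∧ f a' = y ∧ A.G.Adj a a') ∨
       (∃ b b', g b = x ∧ g b' = y ∧ B.G.Adj b b'))) ∧
    C.s = f A.s ∧ C.t = g B.t

/-- `C` is the parallel composition of `A` and `B`: a disjoint union with the two sources
identified and the two sinks identified. -/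
def IsParallelComp (A B C : TwoTerminal) : Prop :=
  ∃ (f : A.V → C.V) (g : B.V → C.V),
    Function.Injective f ∧ Function.Injective g ∧
    (∀ c : C.V, (∃ a, f a = c) ∨ (∃ b, g b = c)) ∧
    (∀ a b, f a = g b ↔ ((a = A.s ∧ b = B.s) ∨ (a = A.t ∧ b = B.t))) ∧
    (∀ x y, C.G.Adj x y ↔
      ((∃ a a', f a = x ∧ f a' = y ∧ A.G.Adj a a') ∨
       (∃ b b', g b = x ∧ g b' = y ∧ B.G.Adj b b'))) ∧
    C.s = f A.s ∧ C.t = f A.t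

/-- Two-terminal series-parallel graphs: generated from `K₂` (an edge, with its two
endpoints as source and sink) by series and parallel compositions. -/
inductive IsTTSP : TwoTerminal → Prop
  | base (A : TwoTerminal) : A.s ≠ A.t → (∀ v : A.V, v = A.s ∨ v = A.t) →
      (∀ x y : A.V, A.G.Adj x y ↔ x ≠ y) → IsTTSP A
  | series (A B C : TwoTerminal) : IsTTSP A → IsTTSP B → IsSeriesComp A B C → IsTTSP C
  | parallel (A B C : TwoTerminal) : IsTTSP A → IsTTSP B → IsParallelComp A B C → IsTTSP C

/-- A graph is series-parallel if it is a two-terminal series-parallel graph for some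
choice of source and sink. -/
def IsSeriesParallel {V : Type} (G : SimpleGraph V) : Prop :=
  ∃ s t : V, IsTTSP ⟨V, G, s, t⟩

namespace SPLower

/-- The vertices of the hard instance. -/
inductive Vx (k : ℕ) : Type
  | s : Vx k
  | u : Fin k → Vx k
  | w : Fin k → Fin k → Vx k
  | z : Fin k → Fin k → Vx k
  | t : Vx k

def vxEquiv (k : ℕ) :
    Vx k ≃ (Unit ⊕ Unit) ⊕ (Fin k ⊕ ((Fin k × Fin k) ⊕ (Fin k × Fin k))) where
  toFun
    | .s => .inl (.inl ())
    | .t => .inl (.inr ())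
    | .u i => .inr (.inl i)
    | .w i j => .inr (.inr (.inl (i, j)))
    | .z i j => .inr (.inr (.inr (i, j)))
  invFun
    | .inl (.inl _) => .s
    | .inl (.inr _) => .t
    | .inr (.inl i) => .u i
    | .inr (.inr (.inl p)) => .w p.1 p.2
    | .inr (.inr (.inr p)) => .z p.1 p.2
  left_inv := by intro x; cases x <;> rfl
  right_inv := by rintro ((_ | _) | (_ | _ | _)) <;> rfl

noncomputable instance (k : ℕ) : Fintype (Vx k) := Fintype.ofEquiv _ (vxEquiv k).symm

lemma card_vx (k : ℕ) : Fintype.card (Vx k) = 2 + k + 2 * k ^ 2 := by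
  rw [Fintype.card_congr (vxEquiv k)]
  simp
  ring

/-- Order class of a vertex. -/
def rk {k : ℕ} : Vx k → ℕ
  | .s => 0
  | .u _ => 1
  | .w _ _ => 2
  | .z _ _ => 3
  | .t => 4

/-- Directed edges. -/
def dir {k : ℕ} (P : Fin k → Prop) : Vx k → Vx k → Prop
  | .s, .u _ => True
  | .u i, .w i' _ => i = i'
  | .w i j, .z i' j' => i = i' ∧ j = j'
  | .z _ _, .t => True
  | .w i _, .t => P i
  | _, _ => False

def gr {k : ℕ} (P : Fin k → Prop) : SimpleGraph (Vx k) where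
  Adj a b := dir P a b ∨ dir P b a
  symm := ⟨fun a b h => h.symm⟩
  loopless := ⟨by intro a h; cases a <;> simp [dir] at h⟩

/-! ### Series-parallel subgraphs -/

def SPs {V : Type} {G : SimpleGraph V} (H : G.Subgraph) (s t : V) : Prop :=
  ∃ (hs : s ∈ H.verts) (ht : t ∈ H.verts), IsTTSP ⟨H.verts, H.coe, ⟨s, hs⟩, ⟨t, ht⟩⟩

lemma SPs.edge {V : Type} {G : SimpleGraph V} {a b : V} (h : G.Adj a b) :
    SPs (G.subgraphOfAdj h) a b := by
  refine ⟨by simp, by simp, IsTTSP.base _ ?_ ?_ ?_⟩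
  · simpa using h.ne
  · rintro ⟨v, hv⟩
    simpa using hv
  · rintro ⟨x, hx⟩ ⟨y, hy⟩
    have := h.ne
    simp at hx hy
    rcases hx with rfl | rfl <;> rcases hy with rfl | rfl <;> simp [this, this.symm]

lemma SPs.series {V : Type} {G : SimpleGraph V} {H K : G.Subgraph} {a m b : V}
    (h1 : SPs H a m) (h2 : SPs K m b) (hi : ∀ x ∈ H.verts, x ∈ K.verts → x = m) :
    SPs (H ⊔ K) a b := by
  obtain ⟨ha, hm, h1⟩ := h1
  obtain ⟨hm', hb, h2⟩ := h2
  refine ⟨Or.inl ha, Or.inr hb, IsTTSP.series _ _ _ h1 h2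
    ⟨fun x => ⟨x.1, Or.inl x.2⟩, fun x => ⟨x.1, Or.inr x.2⟩, ?_, ?_, ?_, ?_, ?_, rfl, rfl⟩⟩
  · intro x y h; simpa [Subtype.ext_iff] using h
  · intro x y h; simpa [Subtype.ext_iff] using h
  · rintro ⟨c, hc | hc⟩
    · exact Or.inl ⟨⟨c, hc⟩, rfl⟩
    · exact Or.inr ⟨⟨c, hc⟩, rfl⟩
  · rintro ⟨x, hx⟩ ⟨y, hy⟩
    rw [Subtype.ext_iff, Subtype.ext_iff, Subtype.ext_iff]
    constructor
    · intro (hxy : x = y)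
      subst hxy
      exact ⟨hi _ hx hy, hi _ hx hy⟩
    · rintro ⟨h, h'⟩
      exact h.trans h'.symm
  · rintro ⟨x, hx⟩ ⟨y, hy⟩
    simp only [Subgraph.coe_adj, Subgraph.sup_adj]
    constructor
    · rintro (h | h)
      · exact Or.inl ⟨⟨x, h.fst_mem⟩, ⟨y, h.snd_mem⟩, rfl, rfl, h⟩
      · exact Or.inr ⟨⟨x, h.fst_mem⟩, ⟨y, h.snd_mem⟩, rfl, rfl, h⟩
    · rintro (⟨a, a', h1, h2, h⟩ | ⟨a, a', h1, h2, h⟩) <;> cases h1 <;> cases h2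
      · exact Or.inl h
      · exact Or.inr h

lemma SPs.parallel {V : Type} {G : SimpleGraph V} {H K : G.Subgraph} {a b : V}
    (h1 : SPs H a b) (h2 : SPs K a b) (hi : ∀ x ∈ H.verts, x ∈ K.verts → x = a ∨ x = b) :
    SPs (H ⊔ K) a b := by
  obtain ⟨ha, hm, h1⟩ := h1
  obtain ⟨hm', hb, h2⟩ := h2
  refine ⟨Or.inl ha, Or.inr hb, IsTTSP.parallel _ _ _ h1 h2
    ⟨fun x => ⟨x.1, Or.inl x.2⟩, fun x => ⟨x.1, Or.inr x.2⟩, ?_, ?_, ?_, ?_, ?_, rfl, rfl⟩⟩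
  · intro x y h; simpa [Subtype.ext_iff] using h
  · intro x y h; simpa [Subtype.ext_iff] using h
  · rintro ⟨c, hc | hc⟩
    · exact Or.inl ⟨⟨c, hc⟩, rfl⟩
    · exact Or.inr ⟨⟨c, hc⟩, rfl⟩
  · rintro ⟨x, hx⟩ ⟨y, hy⟩
    rw [Subtype.ext_iff, Subtype.ext_iff, Subtype.ext_iff, Subtype.ext_iff, Subtype.ext_iff]
    constructor
    · intro (hxy : x = y)
      subst hxy
      exact (hi _ hx hy).imp (fun h => ⟨h, h⟩) (fun h => ⟨h, h⟩)
    · rintro (⟨h, h'⟩ | ⟨h, h'⟩) <;> exact h.trans h'.symm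
  · rintro ⟨x, hx⟩ ⟨y, hy⟩
    simp only [Subgraph.coe_adj, Subgraph.sup_adj]
    constructor
    · rintro (h | h)
      · exact Or.inl ⟨⟨x, h.fst_mem⟩, ⟨y, h.snd_mem⟩, rfl, rfl, h⟩
      · exact Or.inr ⟨⟨x, h.fst_mem⟩, ⟨y, h.snd_mem⟩, rfl, rfl, h⟩
    · rintro (⟨a, a', h1, h2, h⟩ | ⟨a, a', h1, h2, h⟩) <;> cases h1 <;> cases h2
      · exact Or.inl h
      · exact Or.inr h

lemma SPs.family {V ι : Type} [Fintype ι] [Nonempty ι] {G : SimpleGraph V} {H : ι → G.Subgraph}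
    {a b : V} (h : ∀ i, SPs (H i) a b)
    (hi : ∀ i j, i ≠ j → ∀ x ∈ (H i).verts, x ∈ (H j).verts → x = a ∨ x = b) :
    SPs (⨆ i, H i) a b := by
  have key : ∀ F : Finset ι, F.Nonempty → SPs (⨆ i ∈ F, H i) a b := by
    intro F hF
    induction hF using Finset.Nonempty.cons_induction with
    | singleton i => simpa using h i
    | cons i F hiF hF ih =>
      have e : (⨆ j ∈ Finset.cons i F hiF, H j) = H i ⊔ ⨆ j ∈ F, H j := by
        simp [iSup_or, iSup_sup_eq]
      rw [e]
      refine (h i).parallel ih ?_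
      intro x hx hx'
      simp only [Subgraph.verts_iSup, Set.mem_iUnion] at hx'
      obtain ⟨j, hj, hxj⟩ := hx'
      exact hi i j (by rintro rfl; exact hiF hj) x hx hxj
  simpa using key Finset.univ Finset.univ_nonempty

lemma IsTTSP.iso {A B : TwoTerminal} (e : A.V ≃ B.V) (he : ∀ x y, B.G.Adj (e x) (e y) ↔ A.G.Adj x y)
    (hs : e A.s = B.s) (ht : e A.t = B.t) (h : IsTTSP A) : IsTTSP B := by
  have he' : ∀ x y, B.G.Adj x y ↔ A.G.Adj (e.symm x) (e.symm y) := by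
    intro x y; rw [← he]; simp
  cases h with
  | base _ h1 h2 h3 =>
    refine IsTTSP.base _ ?_ ?_ ?_
    · rw [← hs, ← ht]; simpa using h1
    · intro v
      rcases h2 (e.symm v) with h | h
      · left; rw [← hs, ← h]; simp
      · right; rw [← ht, ← h]; simp
    · intro x y; rw [he', h3]; simp
  | series C D _ hC hD hh =>
    obtain ⟨f, g, hf, hg, hc, hfg, hadj, h1, h2⟩ := hh
    refine IsTTSP.series C D _ hC hD ⟨e ∘ f, e ∘ g, e.injective.comp hf, e.injective.comp hg,
      ?_, ?_, ?_, ?_, ?_⟩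
    · intro c
      simpa [← Equiv.eq_symm_apply] using hc (e.symm c)
    · intro a b; simpa using hfg a b
    · intro x y
      rw [he', hadj]
      simp [Equiv.eq_symm_apply]
    · simp [← hs, h1]
    · simp [← ht, h2]
  | parallel C D _ hC hD hh =>
    obtain ⟨f, g, hf, hg, hc, hfg, hadj, h1, h2⟩ := hh
    refine IsTTSP.parallel C D _ hC hD ⟨e ∘ f, e ∘ g, e.injective.comp hf, e.injective.comp hg,
      ?_, ?_, ?_, ?_, ?_⟩
    · intro c
      simpa [← Equiv.eq_symm_apply] using hc (e.symm c)
    · intro a b; simpa using hfg a b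
    · intro x y
      rw [he', hadj]
      simp [Equiv.eq_symm_apply]
    · simp [← hs, h1]
    · simp [← ht, h2]

lemma gr_sps {k : ℕ} [NeZero k] (P : Fin k → Prop) : SPs (⊤ : (gr P).Subgraph) .s .t := by
  have a1 : ∀ i, (gr P).Adj .s (.u i) := fun i => Or.inl trivial
  have a2 : ∀ i j, (gr P).Adj (.u i) (.w i j) := fun i j => Or.inl rfl
  have a3 : ∀ i j, (gr P).Adj (.w i j) (.z i j) := fun i j => Or.inl ⟨rfl, rfl⟩
  have a4 : ∀ i j, (gr P).Adj (.z i j) .t := fun i j => Or.inl trivial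
  have a5 : ∀ i j, P i → (gr P).Adj (.w i j) .t := fun i j h => Or.inl h
  have b1 : ∀ i j, ∃ H : (gr P).Subgraph, SPs H (.w i j) .t ∧
      H.verts = {.w i j, .z i j, .t} ∧ H.Adj (.w i j) (.z i j) ∧ H.Adj (.z i j) .t ∧
      (P i → H.Adj (.w i j) .t) := by
    intro i j
    have c1 : SPs ((gr P).subgraphOfAdj (a3 i j) ⊔ (gr P).subgraphOfAdj (a4 i j)) (.w i j) .t := by
      refine (SPs.edge _).series (SPs.edge _) ?_
      simp
    by_cases hP : P i
    · refine ⟨_, c1.parallel (SPs.edge (a5 i j hP)) ?_, ?_, ?_, ?_, ?_⟩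
      · simp
      · ext x; simp; tauto
      · simp
      · simp
      · simp
    · refine ⟨_, c1, ?_, ?_, ?_, ?_⟩
      · ext x; simp; tauto
      · simp
      · simp
      · simp [hP]
  choose H1 h1 hv1 hA1 hA2 hA3 using b1
  let H2 : Fin k → Fin k → (gr P).Subgraph := fun i j => (gr P).subgraphOfAdj (a2 i j) ⊔ H1 i j
  have h2 : ∀ i, SPs (⨆ j, H2 i j) (.u i) .t := by
    intro i
    refine SPs.family (fun j => (SPs.edge _).series (h1 i j) ?_) ?_
    · simp [hv1]
    · intro j j' hjj x hx hx'
      simp [H2, hv1] at hx hx'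
      rcases hx with (rfl | rfl) | rfl | rfl | rfl <;> simp_all
  let H3 : Fin k → (gr P).Subgraph := fun i => (gr P).subgraphOfAdj (a1 i) ⊔ ⨆ j, H2 i j
  have h3 : SPs (⨆ i, H3 i) .s .t := by
    refine SPs.family (fun i => (SPs.edge _).series (h2 i) ?_) ?_
    · simp [H2, hv1]
    · intro i i' hii x hx hx'
      simp [H3, H2, hv1] at hx hx'
      rcases hx with (rfl | rfl) | ⟨j, (rfl | rfl) | rfl | rfl | rfl⟩ <;> simp_all
  have hle : ∀ i j, H1 i j ≤ ⨆ i, H3 i := fun i j =>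
    le_trans (le_trans le_sup_right (le_iSup (H2 i) j)) (le_trans le_sup_right (le_iSup H3 i))
  have hd : ∀ x y, dir P x y → (⨆ i, H3 i).Adj x y := by
    intro x y hxy
    rcases x with _ | i | ⟨i, j⟩ | ⟨i, j⟩ | _ <;> rcases y with _ | i' | ⟨i', j'⟩ | ⟨i', j'⟩ | _ <;>
      simp only [dir] at hxy
    · exact (le_iSup H3 i').2 (Or.inl (by simp))
    · subst hxy
      exact (le_iSup H3 i).2 (Or.inr ((le_iSup (H2 i) j').2 (Or.inl (by simp))))
    · obtain ⟨rfl, rfl⟩ := hxy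
      exact (hle i j).2 (hA1 i j)
    · exact (hle i j).2 (hA3 i j hxy)
    · exact (hle i j).2 (hA2 i j)
  have htop : (⨆ i, H3 i) = ⊤ := by
    have hadj : ∀ x y, (gr P).Adj x y → (⨆ i, H3 i).Adj x y := by
      rintro x y (h | h)
      · exact hd _ _ h
      · exact (hd _ _ h).symm
    refine top_le_iff.1 ⟨?_, fun x y h => hadj x y h⟩
    intro x _
    rcases x with _ | i | ⟨i, j⟩ | ⟨i, j⟩ | _
    · exact (hadj _ _ (a1 0)).fst_mem
    · exact (hadj _ _ (a1 i)).snd_mem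
    · exact (hadj _ _ (a2 i j)).snd_mem
    · exact (hadj _ _ (a3 i j)).snd_mem
    · exact (hadj _ _ (a4 0 0)).snd_mem
  rwa [htop] at h3

lemma connected_of_parent {W : Type} (G : SimpleGraph W) (f : W → ℕ) (r : W)
    (h : ∀ v, v ≠ r → ∃ p, G.Adj p v ∧ f p < f v) : G.Connected := by
  have key : ∀ n v, f v = n → G.Reachable r v := by
    intro n
    induction n using Nat.strong_induction_on with
    | _ n ih =>
      intro v hv
      by_cases hr : v = r
      · rw [hr]
      · obtain ⟨p, hp, hlt⟩ := h v hr
        exact (ih (f p) (hv ▸ hlt) p rfl).trans hp.reachable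
  haveI : Nonempty W := ⟨r⟩
  exact ⟨fun x y => (key _ x rfl).symm.trans (key _ y rfl)⟩

lemma exists_order (k : ℕ) : ∃ e : Vx k ≃ Fin (Fintype.card (Vx k)),
    ∀ a b, rk a < rk b → e a < e b := by
  let e0 := Fintype.equivFin (Vx k)
  let f : Fin (Fintype.card (Vx k)) → ℕ := fun i => rk (e0.symm i)
  refine ⟨e0.trans (Tuple.sort f).symm, ?_⟩
  intro a b hab
  by_contra hcon
  have := Tuple.monotone_sort f (not_lt.1 hcon)
  simp [f] at this
  omega

lemma exists_parent {k : ℕ} [NeZero k] (P : Fin k → Prop) (v : Vx k) (hv : v ≠ .s) :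
    ∃ p, (gr P).Adj p v ∧ rk p < rk v := by
  rcases v with _ | i | ⟨i, j⟩ | ⟨i, j⟩ | _
  · exact absurd rfl hv
  · exact ⟨.s, Or.inl trivial, by simp [rk]⟩
  · exact ⟨.u i, Or.inl rfl, by simp [rk]⟩
  · exact ⟨.w i j, Or.inl ⟨rfl, rfl⟩, by simp [rk]⟩
  · exact ⟨.z 0 0, Or.inl trivial, by simp [rk]⟩

lemma adj_low {k : ℕ} (P Q : Fin k → Prop) (a b : Vx k) (ha : rk a ≤ 1) :
    (gr P).Adj a b ↔ (gr Q).Adj a b := by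
  rcases a with _ | i | ⟨i, j⟩ | ⟨i, j⟩ | _ <;> simp [rk] at ha <;> cases b <;> simp [gr, dir]

/-- Index of the group of a vertex. -/
def grp {k : ℕ} : Vx k → Option (Fin k)
  | .s => none
  | .u i => some i
  | .w i _ => some i
  | .z i _ => some i
  | .t => none

lemma fiber_bound {k : ℕ} (P : Fin k → Prop) (S : Finset (Vx k)) (hS : IsDomSet (gr P) ↑S)
    (hP : ∀ i, .u i ∈ S ↔ P i) (i : Fin k) :
    (if P i then 1 else k) ≤ (S.filter fun v => grp v = some i).card := by
  split_ifs with h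
  · exact Finset.card_pos.2 ⟨.u i, Finset.mem_filter.2 ⟨(hP i).2 h, rfl⟩⟩
  · let φ : Fin k → Vx k := fun j => if .w i j ∈ S then .w i j else .z i j
    have hmem : ∀ j, φ j ∈ S := by
      intro j
      by_cases hw : .w i j ∈ S
      · simp [φ, hw]
      · simp only [φ, hw, if_false]
        rcases hS (.w i j) with h' | ⟨v, hv, hadj⟩
        · exact absurd h' hw
        · rcases v with _ | i' | ⟨i', j'⟩ | ⟨i', j'⟩ | _ <;> simp [gr, dir] at hadj
          · subst hadj
            exact absurd ((hP _).1 hv) h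
          · obtain ⟨rfl, rfl⟩ := hadj
            exact hv
          · exact absurd hadj h
    have hinj : Function.Injective φ := by
      intro j j' hjj
      simp only [φ] at hjj
      split_ifs at hjj <;> simp_all
    calc k = (Finset.univ.image φ).card := by
          rw [Finset.card_image_of_injective _ hinj]; simp
      _ ≤ _ := by
          apply Finset.card_le_card
          intro v hv
          simp only [Finset.mem_image, Finset.mem_univ, true_and] at hv
          obtain ⟨j, rfl⟩ := hv
          simp only [Finset.mem_filter, hmem, true_and]
          simp only [φ]
          split_ifs <;> rfl

lemma total_bound {k : ℕ} (P : Fin k → Prop) (S : Finset (Vx k)) (hS : IsDomSet (gr P) ↑S)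
    (hP : ∀ i, .u i ∈ S ↔ P i) :
    ∑ i : Fin k, (if P i then 1 else k) ≤ S.card := by
  calc _ ≤ ∑ i : Fin k, (S.filter fun v => grp v = some i).card :=
        Finset.sum_le_sum fun i _ => fiber_bound P S hS hP i
    _ ≤ ∑ o : Option (Fin k), (S.filter fun v => grp v = o).card := by
        rw [Fintype.sum_option]; omega
    _ = S.card := (Finset.card_eq_sum_card_fiberwise (by simp)).symm

lemma dom_upper {k : ℕ} (P : Fin k → Prop) :
    ∃ D : Finset (Vx k), IsDomSet (gr P) ↑D ∧
      D.card ≤ 2 + (Finset.univ.filter fun i => ¬ P i).card := by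
  refine ⟨{.s, .t} ∪ (Finset.univ.filter fun i => ¬ P i).image .u, ?_, ?_⟩
  · intro v
    rcases v with _ | i | ⟨i, j⟩ | ⟨i, j⟩ | _
    · left; simp
    · right; exact ⟨.s, by simp, Or.inl trivial⟩
    · right
      by_cases h : P i
      · exact ⟨.t, by simp, Or.inr h⟩
      · exact ⟨.u i, by simp [h], Or.inl rfl⟩
    · right; exact ⟨.t, by simp, Or.inr trivial⟩
    · left; simp
  · exact (Finset.card_union_le _ _).trans (add_le_add Finset.card_le_two Finset.card_image_le)

lemma ratio {k : ℕ} (hk : 2 ≤ k) (P : Fin k → Prop) (S : Finset (Vx k))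
    (hS : IsDomSet (gr P) ↑S) (hP : ∀ i, .u i ∈ S ↔ P i) :
    ∃ D : Finset (Vx k), IsDomSet (gr P) ↑D ∧ k * D.card ≤ 2 * S.card := by
  obtain ⟨D, hD, hDc⟩ := dom_upper P
  refine ⟨D, hD, ?_⟩
  have hlow := total_bound P S hS hP
  rw [Finset.sum_ite] at hlow
  simp only [Finset.sum_const, smul_eq_mul, mul_one] at hlow
  have htot := Finset.card_filter_add_card_filter_not (s := (Finset.univ : Finset (Fin k))) P
  rw [Finset.card_univ, Fintype.card_fin] at htot
  generalize (Finset.univ.filter fun i => ¬ P i).card = a at *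
  generalize (Finset.univ.filter fun i => P i).card = b at *
  have h1 : k * D.card ≤ k * (2 + a) := Nat.mul_le_mul_left _ hDc
  have h2 : 2 * a ≤ k * a := Nat.mul_le_mul_right _ hk
  nlinarith

/-- The graph relabelled by revelation time. -/
def grn {k n : ℕ} (e : Vx k ≃ Fin n) (P : Fin k → Prop) : SimpleGraph (Fin n) :=
  (gr P).comap e.symm

lemma history_eq {k n : ℕ} (e : Vx k ≃ Fin n) (he : ∀ a b, rk a < rk b → e a < e b)
    (P Q : Fin k → Prop) (i : Fin k) :
    history (grn e P) (e (.u i)) = history (grn e Q) (e (.u i)) := by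
  unfold history
  apply List.map_congr_left
  intro j hj
  rw [List.mem_range] at hj
  ext m
  simp only [Set.mem_ofPred_eq]
  refine exists_congr fun v => exists_congr fun w => and_congr_right fun hv =>
    and_congr_right fun _ => or_congr_right ?_
  apply adj_low
  by_contra hcon
  have := he (.u i) (e.symm v) (by simp [rk] at *; omega)
  rw [Equiv.apply_symm_apply, Fin.lt_def] at this
  omega

end SPLower

/-- Lower bound `k/2` for any deterministic online algorithm on
connected series-parallel graphs on at most `2 + k + 2k²` vertices. -/
theorem series_parallel_lower_bound (A : List (Set ℕ) → Bool) (hA : AlwaysDominating A)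
    (k : ℕ) (hk : 2 ≤ k) :
    ∃ n : ℕ, n ≤ 2 + k + 2 * k ^ 2 ∧ ∃ G : SimpleGraph (Fin n),
      IsSeriesParallel G ∧ G.Connected ∧ PrefixConnected G ∧
      ((k : ℝ) / 2) * (domNum G : ℝ) ≤ ((algOutput A G).card : ℝ) := by
  haveI : NeZero k := ⟨by omega⟩
  obtain ⟨e, he⟩ := SPLower.exists_order k
  let P : Fin k → Prop := fun i =>
    A (history (SPLower.grn e fun _ => False) (e (.u i))) = true
  have hpar : ∀ v, v ≠ e .s → ∃ p, (SPLower.grn e P).Adj p v ∧ p < v := by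
    intro v hv
    obtain ⟨p, hp, hlt⟩ := SPLower.exists_parent P (e.symm v)
      (by intro h; apply hv; rw [← h]; simp)
    refine ⟨e p, by simpa [SPLower.grn] using hp, ?_⟩
    simpa using he _ _ hlt
  have hconn : (SPLower.grn e P).Connected :=
    SPLower.connected_of_parent _ (fun v => (v : ℕ)) (e .s) hpar
  have hmin : ∀ v, e .s ≤ v := by
    intro v
    by_cases h : e.symm v = .s
    · rw [← h]; simp
    · have hlt : SPLower.rk (SPLower.Vx.s : SPLower.Vx k) < SPLower.rk (e.symm v) := by
        revert h
        cases e.symm v <;> simp [SPLower.rk]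
      simpa using (he _ _ hlt).le
  have hpre : PrefixConnected (SPLower.grn e P) := by
    intro i
    refine SPLower.connected_of_parent _ (fun v => (v.1 : ℕ)) ⟨e .s, hmin i⟩ ?_
    rintro ⟨v, hv⟩ hne
    obtain ⟨p, hp, hlt⟩ := hpar v (by simpa using hne)
    exact ⟨⟨p, hlt.le.trans hv⟩, by simpa using hp, hlt⟩
  refine ⟨_, (SPLower.card_vx k).le, SPLower.grn e P, ?_, hconn, hpre, ?_⟩
  · obtain ⟨hs, ht, h⟩ := SPLower.gr_sps P
    refine ⟨e .s, e .t, ?_⟩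
    refine SPLower.IsTTSP.iso ((Equiv.Set.univ _).trans e) ?_ ?_ ?_ h
    · intro x y
      simp [SPLower.grn]
    · simp
    · simp
  · have hdom := hA _ _ hconn hpre
    set S0 := algOutput A (SPLower.grn e P) with hS0
    let S : Finset (SPLower.Vx k) := S0.map e.symm.toEmbedding
    have hcard : S.card = S0.card := Finset.card_map _
    have hmem : ∀ v, v ∈ S ↔ e v ∈ S0 := by
      intro v; simp [S, Equiv.symm_apply_eq]
    have hS : IsDomSet (SPLower.gr P) ↑S := by
      intro v
      rcases hdom (e v) with h | ⟨x, hx, hadj⟩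
      · left; simpa [hmem] using h
      · right
        refine ⟨e.symm x, ?_, by simpa [SPLower.grn] using hadj⟩
        simpa [hmem] using hx
    have hPS : ∀ i, .u i ∈ S ↔ P i := by
      intro i
      rw [hmem, hS0]
      simp only [algOutput, Finset.mem_filter, Finset.mem_univ, true_and, P]
      rw [SPLower.history_eq e he _ (fun _ => False)]
    obtain ⟨D, hD, hDc⟩ := SPLower.ratio hk P S hS hPS
    have hup : domNum (SPLower.grn e P) ≤ D.card := by
      refine Nat.sInf_le ⟨D.map e.toEmbedding, ?_, Finset.card_map _⟩
      intro v
      rcases hD (e.symm v) with h | ⟨x, hx, hadj⟩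
      · left; simpa [← Equiv.eq_symm_apply] using h
      · right
        exact ⟨e x, by simpa using hx, by simpa [SPLower.grn] using hadj⟩
    rw [hcard] at hDc
    have h1 : k * domNum (SPLower.grn e P) ≤ 2 * S0.card :=
      (Nat.mul_le_mul_left _ hup).trans hDc
    have h2 : (k : ℝ) * domNum (SPLower.grn e P) ≤ 2 * S0.card := by exact_mod_cast h1
    linarith
end

section
/- For every connected finite simple graph G on n ≥ 3 vertices and every revelation order v_1,…,v_n of its vertices in which every prefix induces a connected subgraph, the set S of vertices selected by the algorithm ⌈√(n−1)⌉-DOMINATE is a dominating set of G and satisfies |S| ≤ 3·√(n−1)·γ(G); in particular, there is an O(√n)-competitive deterministic online algorithm for the online dominating set problem on general graphs. -/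
open SimpleGraph

attribute [local instance] Classical.propDecidable

/-- Closed neighborhood of a finite set of vertices. -/
noncomputable def closedN {n : ℕ} (G : SimpleGraph (Fin n)) (A : Finset (Fin n)) :
    Finset (Fin n) :=
  Finset.univ.filter fun v => v ∈ A ∨ ∃ u ∈ A, G.Adj u v

/-- `R_i`: the vertices revealed by time `i`. -/
noncomputable def Rset (n : ℕ) (i : ℕ) : Finset (Fin n) :=
  Finset.univ.filter fun v => (v : ℕ) ≤ i

/-- `U_i`: visible vertices undominated just before the decision at time `i`,
given the set `Sprev` of previously selected vertices. -/
noncomputable def Uset {n : ℕ} (G : SimpleGraph (Fin n)) (i : ℕ) (Sprev : Finset (Fin n)) :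
    Finset (Fin n) :=
  closedN G (Rset n i) \ closedN G Sprev

/-- The open neighborhood of a vertex, as a finset. -/
noncomputable def nbrs {n : ℕ} (G : SimpleGraph (Fin n)) (v : Fin n) : Finset (Fin n) :=
  Finset.univ.filter fun w => G.Adj v w

/-- The degree of a vertex. -/
noncomputable def deg {n : ℕ} (G : SimpleGraph (Fin n)) (v : Fin n) : ℕ := (nbrs G v).card

/-- `vj` saves `vm`: `vj` is the last vertex of `N[vm]` in the revelation order and
`N[vm] \ {vj}` contains no previously selected vertex. -/
def Saves {n : ℕ} (G : SimpleGraph (Fin n)) (Sprev : Finset (Fin n)) (vj vm : Fin n) : Prop :=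
  (vj = vm ∨ G.Adj vm vj) ∧
  (∀ w : Fin n, (w = vm ∨ G.Adj vm w) → (w : ℕ) ≤ (vj : ℕ)) ∧
  (∀ w : Fin n, (w = vm ∨ G.Adj vm w) → w ≠ vj → w ∉ Sprev)

/-- Decision of `k`-DOMINATE at vertex `vi` with previously selected set `Sprev`:
select iff `vi` has at least `k` undominated neighbors, or `vi` saves some vertex. -/
def kDomDecision {n : ℕ} (G : SimpleGraph (Fin n)) (k : ℕ) (vi : Fin n)
    (Sprev : Finset (Fin n)) : Prop :=
  k ≤ (nbrs G vi ∩ Uset G (vi : ℕ) Sprev).card ∨ ∃ vm : Fin n, Saves G Sprev vi vm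

/-- The set of vertices selected by `k`-DOMINATE after the first `i` decisions. -/
noncomputable def kDomStep {n : ℕ} (G : SimpleGraph (Fin n)) (k : ℕ) : ℕ → Finset (Fin n)
  | 0 => ∅
  | i + 1 =>
    kDomStep G k i ∪
      if h : i < n then
        if kDomDecision G k ⟨i, h⟩ (kDomStep G k i) then {⟨i, h⟩} else ∅
      else ∅

/-- The output of the online algorithm `k`-DOMINATE. -/
noncomputable def kDomOutput {n : ℕ} (G : SimpleGraph (Fin n)) (k : ℕ) : Finset (Fin n) :=
  kDomStep G k n

theorem mem_kDomStep {n : ℕ} (G : SimpleGraph (Fin n)) (k : ℕ) (i : ℕ) (v : Fin n) :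
    v ∈ kDomStep G k i ↔ (v : ℕ) < i ∧ kDomDecision G k v (kDomStep G k v) := by
  induction i with
  | zero => simp [kDomStep]
  | succ i ih =>
    rw [kDomStep, Finset.mem_union, ih]
    constructor
    · rintro (h | h)
      · exact ⟨by omega, h.2⟩
      · split_ifs at h with h1 h2
        · rw [Finset.mem_singleton] at h
          subst h
          exact ⟨by simp, h2⟩
        · simp at h
        · simp at h
    · rintro ⟨h1, h2⟩
      by_cases h : (v : ℕ) < i
      · exact Or.inl ⟨h, h2⟩
      · right
        have hv : (v : ℕ) = i := by omega
        subst hv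
        simp [h2]

theorem output_dom {n : ℕ} (G : SimpleGraph (Fin n)) (k : ℕ) :
    IsDomSet G ↑(kDomOutput G k) := by
  intro m
  by_contra hc
  push Not at hc
  obtain ⟨hc1, hc2⟩ := hc
  have hnot : ∀ w : Fin n, (w = m ∨ G.Adj m w) → w ∉ kDomOutput G k := by
    rintro w (rfl | hw) hS
    · exact hc1 hS
    · exact hc2 w hS hw.symm
  obtain ⟨j, hj, hmax⟩ := Finset.exists_max_image
    (Finset.univ.filter fun w : Fin n => w = m ∨ G.Adj m w) id ⟨m, by simp⟩
  simp only [Finset.mem_filter, Finset.mem_univ, true_and, id] at hj hmax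
  apply hnot j hj
  rw [kDomOutput, mem_kDomStep]
  refine ⟨j.2, Or.inr ⟨m, hj, fun w hw => hmax w hw, fun w hw _ hS => hnot w hw ?_⟩⟩
  rw [mem_kDomStep] at hS
  rw [kDomOutput, mem_kDomStep]
  exact ⟨w.2, hS.2⟩

theorem heavy_bound {n : ℕ} (G : SimpleGraph (Fin n)) (k : ℕ) :
    (Finset.univ.filter fun v : Fin n =>
      k ≤ (nbrs G v ∩ Uset G (v : ℕ) (kDomStep G k v)).card).card * k ≤ n := by
  set A := Finset.univ.filter fun v : Fin n =>
      k ≤ (nbrs G v ∩ Uset G (v : ℕ) (kDomStep G k v)).card with hA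
  have key : ∀ a ∈ A, ∀ b, a < b →
      Disjoint (nbrs G a ∩ Uset G (a : ℕ) (kDomStep G k a))
        (nbrs G b ∩ Uset G (b : ℕ) (kDomStep G k b)) := by
    intro a ha b hab
    rw [Finset.disjoint_left]
    intro x hx hy
    simp only [Finset.mem_inter, nbrs, Uset, Finset.mem_sdiff, closedN, Finset.mem_filter,
      Finset.mem_univ, true_and] at hx hy
    apply hy.2.2
    right
    refine ⟨a, ?_, hx.1⟩
    rw [mem_kDomStep]
    exact ⟨hab, Or.inl (by simpa [hA] using ha)⟩
  have h1 : (A.biUnion fun v => nbrs G v ∩ Uset G (v : ℕ) (kDomStep G k v)).card ≤ n := by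
    simpa using Finset.card_le_univ
      (A.biUnion fun v => nbrs G v ∩ Uset G (v : ℕ) (kDomStep G k v))
  rw [Finset.card_biUnion] at h1
  · refine le_trans ?_ h1
    rw [← smul_eq_mul]
    apply Finset.card_nsmul_le_sum
    intro x hx
    simpa [hA] using hx
  · intro a ha b hb hab
    rcases lt_or_gt_of_ne hab with h | h
    · exact key a ha b h
    · exact (key b hb a h).symm

theorem saver_bound {n : ℕ} (G : SimpleGraph (Fin n)) (k : ℕ) (hk : 1 ≤ k)
    (D : Finset (Fin n)) (hD : IsDomSet G ↑D) :
    (Finset.univ.filter fun v : Fin n => ∃ m, Saves G (kDomStep G k v) v m).card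
      ≤ k * D.card := by
  set B := Finset.univ.filter fun v : Fin n => ∃ m, Saves G (kDomStep G k v) v m with hB
  have hd : ∀ x : Fin n, ∃ u ∈ D, u = x ∨ G.Adj x u := by
    intro x
    rcases hD x with h | ⟨u, hu, h⟩
    · exact ⟨x, h, Or.inl rfl⟩
    · exact ⟨u, hu, Or.inr h.symm⟩
  choose d hdD hdN using hd
  have hm : ∀ v : Fin n, ∃ m, v ∈ B → Saves G (kDomStep G k v) v m := by
    intro v
    by_cases hv : v ∈ B
    · obtain ⟨m, h⟩ := (Finset.mem_filter.1 hv).2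
      exact ⟨m, fun _ => h⟩
    · exact ⟨v, fun h => absurd h hv⟩
  choose m hm using hm
  refine Finset.card_le_mul_card_image_of_maps_to (f := fun v => d (m v))
    (fun v _ => hdD _) k ?_
  intro u hu
  by_cases hS : kDomDecision G k u (kDomStep G k u)
  · refine le_trans (Finset.card_le_card (t := {u}) ?_) (by simpa using hk)
    intro j hj
    rw [Finset.mem_filter] at hj
    obtain ⟨hjB, hju⟩ := hj
    have hs := hm j hjB
    have hN := hdN (m j)
    rw [hju] at hN
    rw [Finset.mem_singleton]
    by_contra hne
    apply hs.2.2 u hN (Ne.symm hne)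
    rw [mem_kDomStep]
    have h1 := hs.2.1 u hN
    have h2 : (u : ℕ) ≠ j := fun h => hne (Fin.ext h.symm)
    exact ⟨by omega, hS⟩
  · have hlt : (nbrs G u ∩ Uset G (u : ℕ) (kDomStep G k u)).card < k := by
      by_contra h
      exact hS (Or.inl (not_lt.1 h))
    have hins := Finset.card_insert_le u (nbrs G u ∩ Uset G (u : ℕ) (kDomStep G k u))
    refine le_trans (Finset.card_le_card_of_injOn
      (t := insert u (nbrs G u ∩ Uset G (u : ℕ) (kDomStep G k u))) m ?_ ?_) (by omega)
    · intro j hj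
      simp only [Finset.coe_filter, Set.mem_ofPred_eq] at hj
      obtain ⟨hjB, hju⟩ := hj
      have hs := hm j hjB
      have hN := hdN (m j)
      rw [hju] at hN
      rw [Finset.mem_coe, Finset.mem_insert]
      rcases hN with h | h
      · exact Or.inl h.symm
      · right
        have hle := hs.2.1 u (Or.inr h)
        have hno : ∀ w : Fin n, (w = m j ∨ G.Adj (m j) w) → w ∉ kDomStep G k u := by
          intro w hw hwS
          rw [mem_kDomStep] at hwS
          refine hs.2.2 w hw ?_ ?_
          · rintro rfl
            omega
          · rw [mem_kDomStep]
            exact ⟨by omega, hwS.2⟩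
        simp only [Finset.mem_inter, nbrs, Uset, Finset.mem_sdiff, closedN, Finset.mem_filter,
          Finset.mem_univ, true_and]
        refine ⟨h.symm, Or.inr ⟨u, by simp [Rset], h.symm⟩, ?_⟩
        rintro (h' | ⟨w, hw, h'⟩)
        · exact hno _ (Or.inl rfl) h'
        · exact hno w (Or.inr h'.symm) hw
    · intro a ha b hb hab
      simp only [Finset.coe_filter, Set.mem_ofPred_eq] at ha hb
      have h1 := hm a ha.1
      have h2 := hm b hb.1
      rw [← hab] at h2
      apply Fin.ext
      apply le_antisymm
      · exact h2.2.1 a h1.1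
      · exact h1.2.1 b h2.1

/-- On every connected graph on `n ≥ 3` vertices revealed with connected
prefixes, `⌈√(n-1)⌉`-DOMINATE outputs a dominating set of size at most `3·√(n-1)·γ(G)`;
in particular there is an `O(√n)`-competitive deterministic online algorithm on general
graphs. -/
theorem sqrt_dominate_general {n : ℕ} (hn : 3 ≤ n) (G : SimpleGraph (Fin n))
    (hconn : G.Connected) (hpc : PrefixConnected G) :
    IsDomSet G ↑(kDomOutput G ⌈Real.sqrt ((n : ℝ) - 1)⌉₊) ∧
      ((kDomOutput G ⌈Real.sqrt ((n : ℝ) - 1)⌉₊).card : ℝ) ≤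
        3 * Real.sqrt ((n : ℝ) - 1) * (domNum G : ℝ) := by
  refine ⟨output_dom G _, ?_⟩
  obtain ⟨D, hD, hDc⟩ : domNum G ∈ {k | ∃ D : Finset (Fin n), IsDomSet G ↑D ∧ D.card = k} :=
    Nat.sInf_mem ⟨_, Finset.univ, fun v => Or.inl (by simp), rfl⟩
  have hn' : (3 : ℝ) ≤ n := by exact_mod_cast hn
  set s := Real.sqrt ((n : ℝ) - 1) with hs
  have hss : s * s = (n : ℝ) - 1 := Real.mul_self_sqrt (by linarith)
  have hs0 : 0 ≤ s := Real.sqrt_nonneg _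
  have hs1 : 1 ≤ s := by nlinarith
  set k := ⌈s⌉₊ with hkdef
  have hks : s ≤ k := Nat.le_ceil s
  have hks' : (k : ℝ) < s + 1 := Nat.ceil_lt_add_one hs0
  have hk1 : 1 ≤ k := by
    have : (1 : ℝ) ≤ k := le_trans hs1 hks
    exact_mod_cast this
  have hg : (1 : ℝ) ≤ (domNum G : ℝ) := by
    have : 0 < domNum G := by
      rw [← hDc, Finset.card_pos]
      rcases hD ⟨0, by omega⟩ with h | ⟨u, h, _⟩
      · exact ⟨_, h⟩
      · exact ⟨u, h⟩
    exact_mod_cast this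
  have hA := heavy_bound G k
  have hB := saver_bound G k hk1 D hD
  rw [hDc] at hB
  have hsub : (kDomOutput G k).card ≤ _ := (Finset.card_le_card (t :=
    (Finset.univ.filter fun v : Fin n =>
      k ≤ (nbrs G v ∩ Uset G (v : ℕ) (kDomStep G k v)).card) ∪
    (Finset.univ.filter fun v : Fin n => ∃ m, Saves G (kDomStep G k v) v m)) (by
      intro v hv
      rw [kDomOutput, mem_kDomStep] at hv
      rw [Finset.mem_union, Finset.mem_filter, Finset.mem_filter]
      exact hv.2.imp (fun h => ⟨Finset.mem_univ _, h⟩) (fun h => ⟨Finset.mem_univ _, h⟩))).trans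
    (Finset.card_union_le _ _)
  generalize (Finset.univ.filter fun v : Fin n =>
      k ≤ (nbrs G v ∩ Uset G (v : ℕ) (kDomStep G k v)).card).card = a at hA hsub
  generalize (Finset.univ.filter fun v : Fin n =>
      ∃ m, Saves G (kDomStep G k v) v m).card = b at hB hsub
  rcases Nat.lt_or_ge n 4 with h4 | h4
  · have hc : (kDomOutput G k).card ≤ 3 := by
      have := Finset.card_le_univ (kDomOutput G k)
      rw [Fintype.card_fin] at this
      omega
    have hc' : ((kDomOutput G k).card : ℝ) ≤ 3 := by exact_mod_cast hc
    nlinarith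
  · have h4' : (4 : ℝ) ≤ n := by exact_mod_cast h4
    have hA' : (a : ℝ) * k ≤ n := by exact_mod_cast hA
    have hB' : (b : ℝ) ≤ k * domNum G := by exact_mod_cast hB
    have hsub' : ((kDomOutput G k).card : ℝ) ≤ a + b := by exact_mod_cast hsub
    have hphi : s + 1 ≤ s * s := by nlinarith
    have ha : (a : ℝ) ≤ 2 * s - 1 := by
      have h0 : (0 : ℝ) ≤ a := Nat.cast_nonneg a
      have h1 : (a : ℝ) * s ≤ s * s + 1 := by
        have := mul_le_mul_of_nonneg_left hks h0
        linarith
      have h2 : (a : ℝ) * s ≤ (2 * s - 1) * s := by nlinarith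
      exact le_of_mul_le_mul_right h2 (by linarith)
    nlinarith
end
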